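/- arXiv:1601.00613 — 2 statements merged into one kernel-verified Lean document; each statement's English description precedes it below -/
import Mathlib

section
/- Let T_1,…,T_n ∈ B(H) be pairwise doubly commuting contractions, and suppose (K, j, U_1,…,U_n) and (K', j', U_1',…,U_n') are both dilations in the following sense: K, K' are complex Hilbert spaces, j : H → K and j' : H → K' are linear isometries, the U_i ∈ B(K) are pairwise doubly commuting unitaries and likewise the U_i' ∈ B(K'), and for all k_1,…,k_n ∈ ℤ one has T_1(k_1)⋯T_n(k_n) = j* ∘ (U_1^{k_1}⋯U_n^{k_n}) ∘ j and T_1(k_1)⋯T_n(k_n) = j'* ∘ (U_1'^{k_1}⋯U_n'^{k_n}) ∘ j'. If both dilations are minimal, then there exists a unitary operator W : K → K' such that W ∘ j = j' and W ∘ U_i = U_i' ∘ W for all 1 ≤ i ≤ n. -/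
noncomputable section

/-- `T(k)`: integer power, `T^k` for `k ≥ 0` and `(T*)^{-k}` for `k < 0`.
For a unitary `U` this is the integer power of `U`. -/
def opZpow {E : Type*} [NormedAddCommGroup E] [InnerProductSpace ℂ E] [CompleteSpace E]
    (T : E →L[ℂ] E) (k : ℤ) : E →L[ℂ] E :=
  if 0 ≤ k then T ^ k.toNat else (ContinuousLinearMap.adjoint T) ^ (-k).toNat

/-- `S` and `T` doubly commute. -/
def DoublyCommute {E : Type*} [NormedAddCommGroup E] [InnerProductSpace ℂ E] [CompleteSpace E]
    (S T : E →L[ℂ] E) : Prop :=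
  S * T = T * S ∧ star S * T = T * star S

/-- A dilation `(K, j, U)` of a tuple is minimal if the only closed subspace of `K` containing
the range of `j` and invariant under every `U i` and `(U i)*` is `K` itself. -/
def MinimalDilation {H K : Type*} [NormedAddCommGroup H] [InnerProductSpace ℂ H]
    [NormedAddCommGroup K] [InnerProductSpace ℂ K] [CompleteSpace K]
    {n : ℕ} (j : H →ₗᵢ[ℂ] K) (U : Fin n → (K →L[ℂ] K)) : Prop :=
  ∀ S : Submodule ℂ K, IsClosed (S : Set K) → Set.range j ⊆ (S : Set K) →
    (∀ i, ∀ x ∈ S, U i x ∈ S ∧ star (U i) x ∈ S) → S = ⊤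

theorem List.prod_ofFn_mul {M : Type*} [Monoid M] {n : ℕ} (f g : Fin n → M)
    (h : ∀ i j, i ≠ j → Commute (f i) (g j)) :
    (List.ofFn fun i => f i * g i).prod = (List.ofFn f).prod * (List.ofFn g).prod := by
  induction n with
  | zero => simp
  | succ n ih =>
    have hc : Commute (List.ofFn fun i : Fin n => f i.succ).prod (g 0) :=
      Commute.list_prod_left _ _ fun x hx => by
        obtain ⟨i, rfl⟩ := (List.mem_ofFn' _ _).1 hx
        exact h _ _ (Fin.succ_ne_zero i)
    simp only [List.ofFn_succ, List.prod_cons]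
    rw [ih (fun i => f i.succ) (fun i => g i.succ)
      fun i j hij => h _ _ fun he => hij (Fin.succ_injective _ he)]
    simp only [mul_assoc]
    rw [← mul_assoc (g 0), ← hc.eq, mul_assoc]

theorem List.prod_ofFn_mulSingle {M : Type*} [Monoid M] {n : ℕ} (i : Fin n) (a : M) :
    (List.ofFn (Pi.mulSingle (M := fun _ => M) i a)).prod = a := by
  induction n with
  | zero => exact i.elim0
  | succ n ih =>
    rw [List.ofFn_succ, List.prod_cons]
    cases i using Fin.cases with
    | zero => simp
    | succ i =>
      rw [Pi.mulSingle_eq_of_ne (Fin.succ_ne_zero i).symm, one_mul]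
      convert ih i using 4 with j
      simp [Pi.mulSingle_apply]

/-- The monomial `u₁ ^ k₁ ⋯ uₙ ^ kₙ` in a tuple of elements of a group. -/
def zpowProd {G : Type*} [Group G] {n : ℕ} (u : Fin n → G) (k : Fin n → ℤ) : G :=
  (List.ofFn fun i => u i ^ k i).prod

theorem zpowProd_zero {G : Type*} [Group G] {n : ℕ} (u : Fin n → G) : zpowProd u 0 = 1 := by
  simp [zpowProd]

theorem zpowProd_add {G : Type*} [Group G] {n : ℕ} {u : Fin n → G}
    (hu : ∀ i j, i ≠ j → Commute (u i) (u j)) (k l : Fin n → ℤ) :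
    zpowProd u (k + l) = zpowProd u k * zpowProd u l := by
  simp only [zpowProd, Pi.add_apply, zpow_add]
  exact List.prod_ofFn_mul _ _ fun i j hij => (hu i j hij).zpow_zpow _ _

theorem zpowProd_single {G : Type*} [Group G] {n : ℕ} (u : Fin n → G) (i : Fin n) (m : ℤ) :
    zpowProd u (Pi.single i m) = u i ^ m := by
  rw [zpowProd, ← List.prod_ofFn_mulSingle i (u i ^ m)]
  congr 2
  funext j
  by_cases hj : j = i
  · subst hj; simp
  · simp [hj]

section Unitary

variable {E : Type*} [NormedAddCommGroup E] [InnerProductSpace ℂ E] [CompleteSpace E]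

theorem opZpow_coe_unitary (u : unitary (E →L[ℂ] E)) (k : ℤ) :
    opZpow (u : E →L[ℂ] E) k = ((u ^ k : unitary (E →L[ℂ] E)) : E →L[ℂ] E) := by
  unfold opZpow
  split_ifs with hk
  · obtain ⟨m, rfl⟩ := Int.eq_ofNat_of_zero_le hk
    simp
  · obtain ⟨m, hm⟩ := Int.eq_ofNat_of_zero_le (neg_nonneg.2 (not_le.1 hk).le)
    obtain rfl : k = -(m : ℤ) := by omega
    rw [zpow_neg, zpow_natCast, ← inv_pow, ← ContinuousLinearMap.star_eq_adjoint]
    simp [← Unitary.star_eq_inv]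

theorem prod_ofFn_opZpow {n : ℕ} (u : Fin n → unitary (E →L[ℂ] E)) (k : Fin n → ℤ) :
    (List.ofFn fun i => opZpow (u i : E →L[ℂ] E) (k i)).prod = (zpowProd u k).1 := by
  simp only [opZpow_coe_unitary, zpowProd]
  rw [← Submonoid.coe_subtype, map_list_prod, List.map_ofFn]
  rfl

theorem inner_zpowProd_zpowProd {n : ℕ} {u : Fin n → unitary (E →L[ℂ] E)}
    (hu : ∀ i j, i ≠ j → Commute (u i) (u j)) (k l : Fin n → ℤ) (x y : E) :
    inner ℂ ((zpowProd u k).1 x) ((zpowProd u l).1 y) =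
      inner ℂ x ((zpowProd u (l - k)).1 y) := by
  conv_lhs => rw [← add_sub_cancel k l, zpowProd_add hu]
  exact ContinuousLinearMap.inner_map_map_of_mem_unitary (zpowProd u k).2 _ _

theorem zpowProd_add_single_apply {n : ℕ} {u : Fin n → unitary (E →L[ℂ] E)}
    (hu : ∀ i j, i ≠ j → Commute (u i) (u j)) (i : Fin n) (m : ℤ) (k : Fin n → ℤ) (x : E) :
    (zpowProd u (Pi.single i m + k)).1 x =
      ((u i ^ m : unitary (E →L[ℂ] E)) : E →L[ℂ] E) ((zpowProd u k).1 x) := by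
  rw [zpowProd_add hu, zpowProd_single]
  rfl

/-- The orbit of the embedded space under the monomials is total in a minimal dilation. -/
theorem dense_span_of_minimalDilation {H : Type*} [NormedAddCommGroup H] [InnerProductSpace ℂ H]
    {n : ℕ} {u : Fin n → unitary (E →L[ℂ] E)} {j : H →ₗᵢ[ℂ] E}
    (hmin : MinimalDilation j fun i => (u i : E →L[ℂ] E))
    (hu : ∀ i j, i ≠ j → Commute (u i) (u j)) :
    Dense (Submodule.span ℂ (Set.range fun p : (Fin n → ℤ) × H =>
      (zpowProd u p.1).1 (j p.2)) : Set E) := by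
  set S := Submodule.span ℂ (Set.range fun p : (Fin n → ℤ) × H =>
      (zpowProd u p.1).1 (j p.2))
  have mem : ∀ k h, (zpowProd u k).1 (j h) ∈ S := fun k h =>
    Submodule.subset_span (Set.mem_range_self (f := fun p : (Fin n → ℤ) × H =>
      (zpowProd u p.1).1 (j p.2)) (k, h))
  have key : ∀ (i : Fin n) (m : ℤ), ∀ x ∈ S.topologicalClosure,
      ((u i ^ m : unitary (E →L[ℂ] E)) : E →L[ℂ] E) x ∈ S.topologicalClosure := by
    intro i m x hx
    refine map_mem_closure (ContinuousLinearMap.continuous _) hx fun y hy => ?_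
    refine (Submodule.span_le (p := S.comap
      ((u i ^ m : unitary (E →L[ℂ] E)) : E →L[ℂ] E).toLinearMap)).2 ?_ hy
    rintro _ ⟨⟨k, h⟩, rfl⟩
    have hm := mem (Pi.single i m + k) h
    rw [zpowProd_add_single_apply hu] at hm
    exact hm
  rw [Submodule.dense_iff_topologicalClosure_eq_top]
  refine hmin _ S.isClosed_topologicalClosure ?_ fun i x hx => ⟨?_, ?_⟩
  · rintro _ ⟨h, rfl⟩
    exact S.le_topologicalClosure (by simpa [zpowProd_zero] using mem 0 h)
  · simpa using key i 1 x hx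
  · simpa [← Unitary.star_eq_inv] using key i (-1) x hx

end Unitary

/-- Two total families with the same Gram matrix are unitarily equivalent. -/
theorem exists_linearIsometryEquiv_of_inner_eq {𝕜 ι E F : Type*} [RCLike 𝕜]
    [NormedAddCommGroup E] [InnerProductSpace 𝕜 E] [CompleteSpace E]
    [NormedAddCommGroup F] [InnerProductSpace 𝕜 F] [CompleteSpace F]
    (v : ι → E) (w : ι → F) (hv : Dense (Submodule.span 𝕜 (Set.range v) : Set E))
    (hw : Dense (Submodule.span 𝕜 (Set.range w) : Set F))
    (h : ∀ a b, inner 𝕜 (v a) (v b) = inner 𝕜 (w a) (w b)) :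
    ∃ W : E ≃ₗᵢ[𝕜] F, ∀ a, W (v a) = w a := by
  have hdv : DenseRange (Finsupp.linearCombination 𝕜 v) := by
    rw [DenseRange, ← LinearMap.coe_range, Finsupp.range_linearCombination]
    exact hv
  have hdw : DenseRange (Finsupp.linearCombination 𝕜 w) := by
    rw [DenseRange, ← LinearMap.coe_range, Finsupp.range_linearCombination]
    exact hw
  have hnorm : ∀ c : ι →₀ 𝕜, ‖Finsupp.linearCombination 𝕜 w (LinearEquiv.refl 𝕜 _ c)‖ =
      ‖Finsupp.linearCombination 𝕜 v c‖ := fun c => by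
    simp only [@norm_eq_sqrt_re_inner 𝕜, LinearEquiv.refl_apply, Finsupp.linearCombination_apply,
      Finsupp.sum, sum_inner, inner_sum, inner_smul_left, inner_smul_right, h]
  refine ⟨(LinearEquiv.refl 𝕜 (ι →₀ 𝕜)).extendOfIsometry _ _ hdv hdw hnorm, fun a => ?_⟩
  simpa using LinearEquiv.extendOfIsometry_eq (LinearEquiv.refl 𝕜 (ι →₀ 𝕜)) _ _ hdv hdw hnorm
    (Finsupp.single a 1)

/-- Uniqueness up to unitary equivalence of the minimal Sz.-Nagy–Foias dilation of pairwise
doubly commuting contractions. -/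
theorem sz_nagy_foias_dilation_unique {H K K' : Type*}
    [NormedAddCommGroup H] [InnerProductSpace ℂ H] [CompleteSpace H]
    [NormedAddCommGroup K] [InnerProductSpace ℂ K] [CompleteSpace K]
    [NormedAddCommGroup K'] [InnerProductSpace ℂ K'] [CompleteSpace K']
    (n : ℕ) (T : Fin n → (H →L[ℂ] H))
    (hcontr : ∀ i, ‖T i‖ ≤ 1)
    (hdc : ∀ i j, i ≠ j → DoublyCommute (T i) (T j))
    (j : H →ₗᵢ[ℂ] K) (U : Fin n → (K →L[ℂ] K))
    (j' : H →ₗᵢ[ℂ] K') (U' : Fin n → (K' →L[ℂ] K'))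
    (hU : ∀ i, U i ∈ unitary (K →L[ℂ] K))
    (hU' : ∀ i, U' i ∈ unitary (K' →L[ℂ] K'))
    (hUdc : ∀ i i', i ≠ i' → DoublyCommute (U i) (U i'))
    (hU'dc : ∀ i i', i ≠ i' → DoublyCommute (U' i) (U' i'))
    (hdil : ∀ k : Fin n → ℤ,
      (List.ofFn fun i => opZpow (T i) (k i)).prod =
        (ContinuousLinearMap.adjoint j.toContinuousLinearMap).comp
          (((List.ofFn fun i => opZpow (U i) (k i)).prod).comp j.toContinuousLinearMap))
    (hdil' : ∀ k : Fin n → ℤ,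
      (List.ofFn fun i => opZpow (T i) (k i)).prod =
        (ContinuousLinearMap.adjoint j'.toContinuousLinearMap).comp
          (((List.ofFn fun i => opZpow (U' i) (k i)).prod).comp j'.toContinuousLinearMap))
    (hmin : MinimalDilation j U) (hmin' : MinimalDilation j' U') :
    ∃ W : K ≃ₗᵢ[ℂ] K',
      (∀ h : H, W (j h) = j' h) ∧ ∀ i, ∀ x : K, W (U i x) = U' i (W x) := by
  lift U to Fin n → unitary (K →L[ℂ] K) using hU
  lift U' to Fin n → unitary (K' →L[ℂ] K') using hU'
  have hc : ∀ i l, i ≠ l → Commute (U i) (U l) := fun i l hil => Subtype.ext (hUdc i l hil).1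
  have hc' : ∀ i l, i ≠ l → Commute (U' i) (U' l) := fun i l hil => Subtype.ext (hU'dc i l hil).1
  simp only [prod_ofFn_opZpow] at hdil hdil'
  have hd := dense_span_of_minimalDilation hmin hc
  obtain ⟨W, hW⟩ := exists_linearIsometryEquiv_of_inner_eq _ _ hd (dense_span_of_minimalDilation hmin' hc') (by
    rintro ⟨k, x⟩ ⟨l, y⟩
    have e := congrArg (fun A : H →L[ℂ] H => inner ℂ x (A y))
      ((hdil (l - k)).symm.trans (hdil' (l - k)))
    simp only [ContinuousLinearMap.comp_apply, ContinuousLinearMap.adjoint_inner_right,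
      LinearIsometry.coe_toContinuousLinearMap] at e
    simpa only [inner_zpowProd_zpowProd hc, inner_zpowProd_zpowProd hc'] using e)
  refine ⟨W, fun h => by simpa [zpowProd_zero] using hW (0, h), fun i x => ?_⟩
  have hext : (W.toContinuousLinearEquiv : K →L[ℂ] K').comp (U i : K →L[ℂ] K) =
      (U' i : K' →L[ℂ] K').comp (W.toContinuousLinearEquiv : K →L[ℂ] K') := by
    refine ContinuousLinearMap.ext_on hd ?_
    rintro _ ⟨⟨k, h⟩, rfl⟩
    have e := hW (Pi.single i 1 + k, h)
    simp only [zpowProd_add_single_apply hc, zpowProd_add_single_apply hc', zpow_one] at e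
    simpa [hW (k, h)] using e
  exact DFunLike.congr_fun hext x

end
end

section
/- Let K be a complex Hilbert space, let ψ be a state on B(K), and let U_1,…,U_n ∈ B(K) be unitaries that are freely independent with respect to ψ. Then ψ is tracial on C*(U_1,…,U_n): for all a, b ∈ C*(U_1,…,U_n) one has ψ(a b) = ψ(b a). -/
noncomputable section

variable {E : Type*} [NormedAddCommGroup E] [InnerProductSpace ℂ E] [CompleteSpace E]

/-- The unital C*-subalgebra of `B(E)` generated by a set of operators. -/
def CstarGen (s : Set (E →L[ℂ] E)) : StarSubalgebra ℂ (E →L[ℂ] E) :=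
  (StarAlgebra.adjoin ℂ s).topologicalClosure

/-- `ψ` is a state on `B(E)`. -/
def IsState (ψ : (E →L[ℂ] E) →ₗ[ℂ] ℂ) : Prop :=
  ψ 1 = 1 ∧ ∀ a : E →L[ℂ] E, ∃ r : ℝ, 0 ≤ r ∧ ψ (star a * a) = (r : ℂ)

/-- `U 1, …, U n` are freely independent (`*`-free) with respect to `ψ`. -/
def FreeIndep (ψ : (E →L[ℂ] E) →ₗ[ℂ] ℂ) {n : ℕ} (U : Fin n → (E →L[ℂ] E)) : Prop :=
  ∀ (m : ℕ), 0 < m → ∀ i : Fin m → Fin n,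
    (∀ (j : ℕ) (hj : j + 1 < m), i ⟨j, Nat.lt_of_succ_lt hj⟩ ≠ i ⟨j + 1, hj⟩) →
    ∀ a : Fin m → (E →L[ℂ] E), (∀ j, a j ∈ CstarGen {U (i j)}) →
    (∀ j, ψ (a j) = 0) → ψ (List.ofFn fun j => a j).prod = 0

section FreeProduct

variable {ι B : Type*} [Ring B] [Algebra ℂ B]

/-- A list of pairs `(i, a)` is an alternating centered word if consecutive indices differ and
each letter `a` lies in `A i` and in the kernel of `ψ`. -/
structure IsCenteredWord (A : ι → Subalgebra ℂ B) (ψ : B →ₗ[ℂ] ℂ) (l : List (ι × B)) : Prop where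
  isChain : l.IsChain fun p q => p.1 ≠ q.1
  mem : ∀ p ∈ l, p.2 ∈ A p.1
  map_eq_zero : ∀ p ∈ l, ψ p.2 = 0

/-- The linear span of the products of alternating centered words. -/
def centeredWordSpan (A : ι → Subalgebra ℂ B) (ψ : B →ₗ[ℂ] ℂ) : Submodule ℂ B :=
  Submodule.span ℂ {b | ∃ l, IsCenteredWord A ψ l ∧ (l.map Prod.snd).prod = b}

variable {A : ι → Subalgebra ℂ B} {ψ : B →ₗ[ℂ] ℂ}

theorem map_sub_smul_one (h1 : ψ 1 = 1) (x : B) : ψ (x - ψ x • 1) = 0 := by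
  simp [h1]

theorem sub_smul_one_mem {i : ι} {x : B} (hx : x ∈ A i) (c : ℂ) : x - c • 1 ∈ A i :=
  sub_mem hx ((A i).smul_mem (one_mem _) c)

namespace IsCenteredWord

theorem nil : IsCenteredWord A ψ [] := ⟨by simp, by simp, by simp⟩

theorem tail {p : ι × B} {l : List (ι × B)} (h : IsCenteredWord A ψ (p :: l)) :
    IsCenteredWord A ψ l :=
  ⟨(List.isChain_cons.1 h.isChain).2, fun q hq => h.mem q (by simp [hq]),
    fun q hq => h.map_eq_zero q (by simp [hq])⟩

theorem dropLast {p : ι × B} {l : List (ι × B)} (h : IsCenteredWord A ψ (l ++ [p])) :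
    IsCenteredWord A ψ l :=
  ⟨(List.isChain_append.1 h.isChain).1, fun q hq => h.mem q (by simp [hq]),
    fun q hq => h.map_eq_zero q (by simp [hq])⟩

theorem cons {i : ι} {x : B} {l : List (ι × B)} (h : IsCenteredWord A ψ l) (hx : x ∈ A i)
    (hx0 : ψ x = 0) (hl : ∀ p ∈ l.head?, i ≠ p.1) : IsCenteredWord A ψ ((i, x) :: l) :=
  ⟨List.isChain_cons.2 ⟨hl, h.isChain⟩, List.forall_mem_cons.2 ⟨hx, h.mem⟩,
    List.forall_mem_cons.2 ⟨hx0, h.map_eq_zero⟩⟩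

theorem concat {i : ι} {x : B} {l : List (ι × B)} (h : IsCenteredWord A ψ l) (hx : x ∈ A i)
    (hx0 : ψ x = 0) (hl : ∀ p ∈ l.getLast?, p.1 ≠ i) : IsCenteredWord A ψ (l ++ [(i, x)]) :=
  ⟨List.isChain_append.2 ⟨h.isChain, by simp, by simpa using hl⟩,
    List.forall_mem_append.2 ⟨h.mem, by simpa using hx⟩,
    List.forall_mem_append.2 ⟨h.map_eq_zero, by simpa using hx0⟩⟩

theorem prod_mem {l : List (ι × B)} (h : IsCenteredWord A ψ l) :
    (l.map Prod.snd).prod ∈ centeredWordSpan A ψ :=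
  Submodule.subset_span ⟨l, h, rfl⟩

theorem replace_head {i : ι} {a x : B} {l : List (ι × B)} (h : IsCenteredWord A ψ ((i, a) :: l))
    (hx : x ∈ A i) (hx0 : ψ x = 0) : IsCenteredWord A ψ ((i, x) :: l) :=
  h.tail.cons hx hx0 (List.isChain_cons.1 h.isChain).1

theorem replace_last {i : ι} {a x : B} {l : List (ι × B)} (h : IsCenteredWord A ψ (l ++ [(i, a)]))
    (hx : x ∈ A i) (hx0 : ψ x = 0) : IsCenteredWord A ψ (l ++ [(i, x)]) :=
  h.dropLast.concat hx hx0 fun p hp => (List.isChain_append.1 h.isChain).2.2 p hp (i, a) (by simp)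

theorem mul_prod_mem (h1 : ψ 1 = 1) {i : ι} {x : B} (hx : x ∈ A i) {l : List (ι × B)}
    (h : IsCenteredWord A ψ l) : x * (l.map Prod.snd).prod ∈ centeredWordSpan A ψ := by
  by_cases hl : ∀ p ∈ l.head?, i ≠ p.1
  · have hw := (h.cons (sub_smul_one_mem hx (ψ x)) (map_sub_smul_one h1 x) hl).prod_mem
    convert add_mem hw (Submodule.smul_mem _ (ψ x) h.prod_mem) using 1
    simp [sub_mul]
  · obtain _ | ⟨⟨j, a⟩, l⟩ := l
    · simp at hl
    obtain rfl : i = j := by simpa using hl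
    have hxa : x * a ∈ A i := mul_mem hx (h.mem (i, a) (by simp))
    have hw := (h.replace_head (sub_smul_one_mem hxa (ψ (x * a)))
      (map_sub_smul_one h1 _)).prod_mem
    convert add_mem hw (Submodule.smul_mem _ (ψ (x * a)) h.tail.prod_mem) using 1
    simp [sub_mul, mul_assoc]

variable (hfree : ∀ l, l ≠ [] → IsCenteredWord A ψ l → ψ (l.map Prod.snd).prod = 0)

include hfree

theorem map_mul_prod (h1 : ψ 1 = 1) {i : ι} {x : B} (hx : x ∈ A i) (hx0 : ψ x = 0)
    {l : List (ι × B)} (h : IsCenteredWord A ψ l) (hlen : 2 ≤ l.length) :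
    ψ (x * (l.map Prod.snd).prod) = 0 := by
  by_cases hl : ∀ p ∈ l.head?, i ≠ p.1
  · simpa using hfree _ (by simp) (h.cons hx hx0 hl)
  · obtain _ | ⟨⟨j, a⟩, l⟩ := l
    · simp at hlen
    obtain rfl : i = j := by simpa using hl
    have hne : l ≠ [] := by rintro rfl; simp at hlen
    have hxa : x * a ∈ A i := mul_mem hx (h.mem (i, a) (by simp))
    have hw := hfree _ (by simp) (h.replace_head (sub_smul_one_mem hxa (ψ (x * a)))
      (map_sub_smul_one h1 _))
    simpa [sub_mul, mul_assoc, hfree l hne h.tail] using hw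

theorem map_prod_mul (h1 : ψ 1 = 1) {i : ι} {x : B} (hx : x ∈ A i) (hx0 : ψ x = 0)
    {l : List (ι × B)} (h : IsCenteredWord A ψ l) (hlen : 2 ≤ l.length) :
    ψ ((l.map Prod.snd).prod * x) = 0 := by
  by_cases hl : ∀ p ∈ l.getLast?, p.1 ≠ i
  · simpa using hfree _ (by simp) (h.concat hx hx0 hl)
  · obtain rfl | ⟨l, ⟨j, a⟩, rfl⟩ := l.eq_nil_or_concat'
    · simp at hlen
    obtain rfl : j = i := by simpa using hl
    have hne : l ≠ [] := by rintro rfl; simp at hlen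
    have hax : a * x ∈ A j := mul_mem (h.mem (j, a) (by simp)) hx
    have hw := hfree _ (by simp) (h.replace_last (sub_smul_one_mem hax (ψ (a * x)))
      (map_sub_smul_one h1 _))
    simpa [mul_sub, mul_assoc, hfree l hne h.dropLast] using hw

theorem map_mul_prod_comm (h1 : ψ 1 = 1)
    (hA : ∀ i, ∀ x ∈ A i, ∀ y ∈ A i, ψ (x * y) = ψ (y * x)) {i : ι} {x : B} (hx : x ∈ A i)
    {l : List (ι × B)} (h : IsCenteredWord A ψ l) :
    ψ (x * (l.map Prod.snd).prod) = ψ ((l.map Prod.snd).prod * x) := by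
  wlog hx0 : ψ x = 0 generalizing x
  · have hw := this (sub_smul_one_mem hx (ψ x)) (map_sub_smul_one h1 x)
    simpa [sub_mul, mul_sub] using hw
  match l, h with
  | [], _ => simp
  | [(j, a)], h =>
    have ha : a ∈ A j := h.mem (j, a) (by simp)
    have ha0 : ψ a = 0 := h.map_eq_zero (j, a) (by simp)
    by_cases hij : i = j
    · subst hij
      simpa using hA i x hx a ha
    · have hxa := hfree _ (by simp) ((nil.cons ha ha0 (by simp)).cons hx hx0 (by simpa using hij))
      have hax := hfree _ (by simp)
        ((nil.cons hx hx0 (by simp)).cons ha ha0 (by simpa using Ne.symm hij))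
      simpa using (hxa.trans hax.symm)
  | p :: q :: l, h =>
    rw [h.map_mul_prod hfree h1 hx hx0 (by simp), h.map_prod_mul hfree h1 hx hx0 (by simp)]

end IsCenteredWord

theorem mem_centeredWordSpan_of_mem_adjoin (h1 : ψ 1 = 1) {b : B}
    (hb : b ∈ Algebra.adjoin ℂ (⋃ i, (A i : Set B))) : b ∈ centeredWordSpan A ψ := by
  suffices ∀ s ∈ centeredWordSpan A ψ, b * s ∈ centeredWordSpan A ψ by
    simpa using this 1 (by simpa using IsCenteredWord.nil.prod_mem)
  induction hb using Algebra.adjoin_induction with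
  | mem x hx =>
    obtain ⟨i, hi⟩ := Set.mem_iUnion.1 hx
    intro s hs
    induction hs using Submodule.span_induction with
    | mem w hw =>
      obtain ⟨l, hl, rfl⟩ := hw
      exact hl.mul_prod_mem h1 hi
    | zero => simp
    | add y z _ _ hy hz => rw [mul_add]; exact add_mem hy hz
    | smul c y _ hy => rw [mul_smul_comm]; exact Submodule.smul_mem _ c hy
  | algebraMap r =>
    intro s hs
    rw [← Algebra.smul_def]
    exact Submodule.smul_mem _ r hs
  | add x y _ _ hx hy => exact fun s hs => by rw [add_mul]; exact add_mem (hx s hs) (hy s hs)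
  | mul x y _ _ hx hy => exact fun s hs => by rw [mul_assoc]; exact hx _ (hy s hs)

/-- A functional that is tracial on each member of a free family of subalgebras is tracial on the
algebra they generate. -/
theorem map_mul_comm_of_free (h1 : ψ 1 = 1)
    (hA : ∀ i, ∀ x ∈ A i, ∀ y ∈ A i, ψ (x * y) = ψ (y * x))
    (hfree : ∀ l, l ≠ [] → IsCenteredWord A ψ l → ψ (l.map Prod.snd).prod = 0)
    {a b : B} (ha : a ∈ Algebra.adjoin ℂ (⋃ i, (A i : Set B)))
    (hb : b ∈ Algebra.adjoin ℂ (⋃ i, (A i : Set B))) : ψ (a * b) = ψ (b * a) := by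
  induction ha using Algebra.adjoin_induction generalizing b with
  | mem x hx =>
    obtain ⟨i, hi⟩ := Set.mem_iUnion.1 hx
    have hspan := mem_centeredWordSpan_of_mem_adjoin h1 hb
    clear hb
    induction hspan using Submodule.span_induction with
    | mem w hw =>
      obtain ⟨l, hl, rfl⟩ := hw
      exact hl.map_mul_prod_comm hfree h1 hA hi
    | zero => simp
    | add y z _ _ hy hz => rw [mul_add, add_mul, map_add, map_add, hy, hz]
    | smul c y _ hy => rw [mul_smul_comm, smul_mul_assoc, map_smul, map_smul, hy]
  | algebraMap r => rw [Algebra.commutes]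
  | add x y _ _ hx hy => rw [mul_add, add_mul, map_add, map_add, hx hb, hy hb]
  | mul x y hx hy ihx ihy =>
    rw [mul_assoc, ihx (mul_mem hy hb), mul_assoc, ihy (mul_mem hb hx), mul_assoc]

end FreeProduct

open scoped ComplexOrder in
theorem IsState.continuous {ψ : (E →L[ℂ] E) →ₗ[ℂ] ℂ} (hψ : IsState ψ) : Continuous ψ := by
  have hpos (a : E →L[ℂ] E) (ha : 0 ≤ a) : 0 ≤ ψ a := by
    obtain ⟨b, rfl⟩ := CStarAlgebra.nonneg_iff_eq_star_mul_self.1 ha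
    obtain ⟨r, hr, h⟩ := hψ.2 b
    rw [h]
    exact_mod_cast hr
  let _ : CStarAlgebra (E →L[ℂ] E) := {}
  let f : (E →L[ℂ] E) →ₚ[ℂ] ℂ := PositiveLinearMap.mk₀ ψ hpos
  exact map_continuous f

theorem CstarGen_singleton_mul_comm {u : E →L[ℂ] E} [IsStarNormal u] {a b : E →L[ℂ] E}
    (ha : a ∈ CstarGen {u}) (hb : b ∈ CstarGen {u}) : a * b = b * a :=
  congrArg Subtype.val (mul_comm (⟨a, ha⟩ : StarAlgebra.elemental ℂ u) ⟨b, hb⟩)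

theorem FreeIndep.map_prod_eq_zero {ψ : (E →L[ℂ] E) →ₗ[ℂ] ℂ} {n : ℕ} {U : Fin n → (E →L[ℂ] E)}
    (hU : FreeIndep ψ U) {l : List (Fin n × (E →L[ℂ] E))} (hne : l ≠ [])
    (hl : IsCenteredWord (fun i => (CstarGen {U i}).toSubalgebra) ψ l) :
    ψ (l.map Prod.snd).prod = 0 := by
  have h := hU l.length (List.length_pos_iff.2 hne) (fun j => (l.get j).1)
    (fun j hj => List.isChain_iff_getElem.1 hl.isChain j hj) (fun j => (l.get j).2)
    (fun j => hl.mem _ (l.get_mem j)) (fun j => hl.map_eq_zero _ (l.get_mem j))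
  rwa [show (List.ofFn fun j => (l.get j).2) = l.map Prod.snd by
    rw [← Function.comp_def Prod.snd l.get, ← List.map_ofFn, List.ofFn_get]] at h

theorem mem_adjoin_iUnion_CstarGen {n : ℕ} (U : Fin n → (E →L[ℂ] E))
    {a : E →L[ℂ] E} (ha : a ∈ StarAlgebra.adjoin ℂ (Set.range U)) :
    a ∈ Algebra.adjoin ℂ (⋃ i, ((CstarGen {U i}).toSubalgebra : Set (E →L[ℂ] E))) := by
  rw [← StarSubalgebra.mem_toSubalgebra, StarAlgebra.adjoin_toSubalgebra] at ha
  refine Algebra.adjoin_mono ?_ ha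
  have hmem (i) : U i ∈ CstarGen {U i} := StarAlgebra.elemental.self_mem ℂ (U i)
  rintro x (⟨i, rfl⟩ | ⟨i, hi⟩)
  · exact Set.mem_iUnion.2 ⟨i, hmem i⟩
  · exact Set.mem_iUnion.2 ⟨i, by simpa [hi] using star_mem (hmem i)⟩

/-- A state with respect to which unitaries `U 1, …, U n` are freely independent is tracial on
`C*(U_1,…,U_n)`. -/
theorem state_tracial_on_free_unitaries {K : Type*}
    [NormedAddCommGroup K] [InnerProductSpace ℂ K] [CompleteSpace K]
    (ψ : (K →L[ℂ] K) →ₗ[ℂ] ℂ) (hψ : IsState ψ)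
    (n : ℕ) (U : Fin n → (K →L[ℂ] K))
    (hU : ∀ i, U i ∈ unitary (K →L[ℂ] K))
    (hUfree : FreeIndep ψ U) :
    ∀ a ∈ CstarGen (Set.range U), ∀ b ∈ CstarGen (Set.range U),
      ψ (a * b) = ψ (b * a) := by
  have hcont := hψ.continuous
  have hdense : ∀ a ∈ StarAlgebra.adjoin ℂ (Set.range U),
      ∀ b ∈ StarAlgebra.adjoin ℂ (Set.range U), ψ (a * b) = ψ (b * a) := by
    intro a ha b hb
    refine map_mul_comm_of_free hψ.1 (fun i x hx y hy => ?_)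
      (fun l hne hl => hUfree.map_prod_eq_zero hne hl)
      (mem_adjoin_iUnion_CstarGen U ha) (mem_adjoin_iUnion_CstarGen U hb)
    have : IsStarNormal (U i) := ⟨by
      rw [commute_iff_eq, Unitary.star_mul_self_of_mem (hU i),
        Unitary.mul_star_self_of_mem (hU i)]⟩
    rw [CstarGen_singleton_mul_comm hx hy]
  intro a ha b hb
  have hab : (a, b) ∈ closure ((StarAlgebra.adjoin ℂ (Set.range U) : Set (K →L[ℂ] K)) ×ˢ
      (StarAlgebra.adjoin ℂ (Set.range U) : Set (K →L[ℂ] K))) := by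
    rw [closure_prod_eq]
    exact ⟨ha, hb⟩
  have hclosed : IsClosed {p : (K →L[ℂ] K) × (K →L[ℂ] K) | ψ (p.1 * p.2) = ψ (p.2 * p.1)} :=
    isClosed_eq (hcont.comp (continuous_fst.mul continuous_snd))
      (hcont.comp (continuous_snd.mul continuous_fst))
  exact closure_minimal (fun p hp => hdense _ hp.1 _ hp.2) hclosed hab

end
end
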